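/- arXiv:2007.00666 — 2 statements merged into one kernel-verified Lean document; each statement's English description precedes it below -/
import Mathlib

section
/- Let R > 0 and define the high-temperature non-equilibrium Landau potential F : ℝ → ℝ by F(Φ) = Φ²/2 − log h_R(Φ/√2). Then F is smooth in a neighborhood of 0 and its derivatives at 0 are: F'(0) = c₁ where c₁ = √2·Γ((1+R)/2)/Γ(R/2); F''(0) = 1 − R + c₁² (equal to twice the coefficient a₂ = (1−R)/2 + c₁²/2); and F'''(0) = 2c₁·(c₁² + 1/2 − R) (equal to six times the coefficient c₃ = (c₁/3)·(c₁² + 1/2 − R)). -/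
open Real MeasureTheory Filter Topology

/-- `hFun R x = ∫₀^∞ t^(R-1) exp(-t² - 2xt) dt`, i.e. `Γ(R) · H(-R, x)`. -/
noncomputable def hFun (R x : ℝ) : ℝ :=
  ∫ t in Set.Ioi (0 : ℝ), t ^ (R - 1) * Real.exp (-t ^ 2 - 2 * x * t)

/-- The high-temperature non-equilibrium Landau potential `F(Φ) = Φ²/2 - log h_R(Φ/√2)`. -/
noncomputable def Fpot (R : ℝ) : ℝ → ℝ :=
  fun Φ => Φ ^ 2 / 2 - Real.log (hFun R (Φ / Real.sqrt 2))

/-- The linear coefficient `c₁ = √2·Γ((1+R)/2)/Γ(R/2)`. -/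
noncomputable def c₁ (R : ℝ) : ℝ :=
  Real.sqrt 2 * Real.Gamma ((1 + R) / 2) / Real.Gamma (R / 2)

/-- Completing the square bounds the integrand of `hFun` by a Gaussian. -/
lemma exp_neg_sq_sub_le {x t C : ℝ} (ht : 0 < t) (hx : |x| ≤ C) :
    Real.exp (-t ^ 2 - 2 * x * t) ≤ Real.exp (2 * C ^ 2) * Real.exp (-(1 / 2) * t ^ 2) := by
  rw [← Real.exp_add]
  apply Real.exp_le_exp.mpr
  nlinarith [sq_nonneg (t - 2 * C), mul_le_mul_of_nonneg_right (neg_le_of_abs_le hx) ht.le]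

lemma integrableOn_gaussian_bound {s : ℝ} (hs : -1 < s) (C : ℝ) :
    IntegrableOn (fun t : ℝ => t ^ s * (Real.exp (2 * C ^ 2) * Real.exp (-(1 / 2) * t ^ 2)))
      (Set.Ioi 0) := by
  have h := (integrableOn_rpow_mul_exp_neg_mul_sq (b := 1 / 2) (by norm_num) hs).const_mul
    (Real.exp (2 * C ^ 2))
  refine h.congr (ae_of_all _ fun t => ?_)
  ring

lemma aestronglyMeasurable_hFun_integrand (s x : ℝ) :
    AEStronglyMeasurable (fun t : ℝ => t ^ s * Real.exp (-t ^ 2 - 2 * x * t))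
      (volume.restrict (Set.Ioi 0)) :=
  Measurable.aestronglyMeasurable (by fun_prop)

lemma integrableOn_hFun_integrand {s : ℝ} (hs : -1 < s) (x : ℝ) :
    IntegrableOn (fun t : ℝ => t ^ s * Real.exp (-t ^ 2 - 2 * x * t)) (Set.Ioi 0) := by
  refine (integrableOn_gaussian_bound hs |x|).mono' (aestronglyMeasurable_hFun_integrand s x) ?_
  filter_upwards [ae_restrict_mem measurableSet_Ioi] with t ht
  have ht : 0 < t := ht
  rw [Real.norm_of_nonneg (by positivity)]
  gcongr
  exact exp_neg_sq_sub_le ht le_rfl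

lemma hFun_pos {R : ℝ} (hR : 0 < R) (x : ℝ) : 0 < hFun R x := by
  have hpos : ∀ t ∈ Set.Ioi (0 : ℝ), 0 < t ^ (R - 1) * Real.exp (-t ^ 2 - 2 * x * t) :=
    fun t ht => mul_pos (Real.rpow_pos_of_pos ht _) (Real.exp_pos _)
  rw [hFun, setIntegral_pos_iff_support_of_nonneg_ae
    (ae_restrict_of_forall_mem measurableSet_Ioi fun t ht => (hpos t ht).le)
    (integrableOn_hFun_integrand (by linarith) x)]
  have hsupp : Set.Ioi 0 ⊆ Function.support
      fun t : ℝ => t ^ (R - 1) * Real.exp (-t ^ 2 - 2 * x * t) := fun t ht => (hpos t ht).ne'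
  rw [Set.inter_eq_right.mpr hsupp]
  simp

lemma hasDerivAt_hFun {R : ℝ} (hR : 0 < R) (x : ℝ) :
    HasDerivAt (hFun R) (-2 * hFun (R + 1) x) x := by
  have key := hasDerivAt_integral_of_dominated_loc_of_deriv_le
    (μ := volume.restrict (Set.Ioi (0 : ℝ))) (x₀ := x) (Metric.ball_mem_nhds x one_pos)
    (F := fun y t => t ^ (R - 1) * Real.exp (-t ^ 2 - 2 * y * t))
    (F' := fun y t => -2 * (t ^ (R + 1 - 1) * Real.exp (-t ^ 2 - 2 * y * t)))
    (bound := fun t => 2 * (t ^ (R + 1 - 1) *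
      (Real.exp (2 * (|x| + 1) ^ 2) * Real.exp (-(1 / 2) * t ^ 2))))
    (Eventually.of_forall fun y => aestronglyMeasurable_hFun_integrand _ y)
    (integrableOn_hFun_integrand (by linarith) x)
    ((aestronglyMeasurable_hFun_integrand _ x).const_mul _)
    (by
      filter_upwards [ae_restrict_mem measurableSet_Ioi] with t ht y hy
      have ht : 0 < t := ht
      rw [norm_mul, Real.norm_of_nonneg (r := t ^ _ * _) (by positivity)]
      norm_num only [norm_neg, Real.norm_ofNat]
      gcongr
      apply exp_neg_sq_sub_le ht
      rw [Metric.mem_ball, Real.dist_eq] at hy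
      linarith [abs_sub_abs_le_abs_sub y x])
    ((integrableOn_gaussian_bound (by linarith) _).const_mul 2)
    (by
      filter_upwards [ae_restrict_mem measurableSet_Ioi] with t ht y hy
      have ht : 0 < t := ht
      have h : HasDerivAt (fun y : ℝ => -t ^ 2 - 2 * y * t) (-(2 * 1 * t)) y :=
        (((hasDerivAt_id y).const_mul 2).mul_const t).const_sub _
      refine (h.exp.const_mul (t ^ (R - 1))).congr_deriv ?_
      rw [add_sub_right_comm, Real.rpow_add_one ht.ne']
      ring)
  have h := key.2
  rw [integral_const_mul] at h
  exact h

lemma contDiff_hFun (n : ℕ) {R : ℝ} (hR : 0 < R) : ContDiff ℝ n (hFun R) := by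
  induction n generalizing R with
  | zero =>
    exact contDiff_zero.mpr (continuous_iff_continuousAt.mpr fun x =>
      (hasDerivAt_hFun hR x).continuousAt)
  | succ n ih =>
    push_cast
    rw [contDiff_succ_iff_deriv]
    refine ⟨fun x => (hasDerivAt_hFun hR x).differentiableAt, by simp, ?_⟩
    rw [funext fun x => (hasDerivAt_hFun hR x).deriv]
    exact contDiff_const.mul (ih (by linarith))

lemma contDiff_Fpot {R : ℝ} (hR : 0 < R) : ContDiff ℝ (⊤ : ℕ∞) (Fpot R) := by
  have h : ContDiff ℝ (⊤ : ℕ∞) (hFun R) := contDiff_infty.mpr fun n => contDiff_hFun n hR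
  exact ((contDiff_id.pow 2).div_const 2).sub
    ((h.comp (contDiff_id.div_const _)).log fun x => (hFun_pos hR _).ne')

lemma hFun_zero {R : ℝ} (hR : 0 < R) : hFun R 0 = Real.Gamma (R / 2) / 2 := by
  have h := integral_rpow_mul_exp_neg_rpow (p := 2) (q := R - 1) two_pos (by linarith)
  simp only [Real.rpow_two, sub_add_cancel] at h
  simp only [hFun, mul_zero, zero_mul, sub_zero, h]
  ring

lemma hFun_add_two_zero {R : ℝ} (hR : 0 < R) : hFun (R + 2) 0 = R / 2 * hFun R 0 := by
  rw [hFun_zero hR, hFun_zero (by linarith), show (R + 2) / 2 = R / 2 + 1 by ring,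
    Real.Gamma_add_one (by positivity)]
  ring

lemma hasDerivAt_hFun_div_sqrt_two {R : ℝ} (hR : 0 < R) (x : ℝ) :
    HasDerivAt (fun Φ => hFun R (Φ / √2)) (-√2 * hFun (R + 1) (x / √2)) x := by
  have h := (hasDerivAt_hFun hR (x / √2)).comp x ((hasDerivAt_id x).div_const (√2))
  refine h.congr_deriv ?_
  have h2 : √2 ^ 2 = 2 := Real.sq_sqrt two_pos.le
  field_simp
  rw [h2]

lemma deriv_Fpot {R : ℝ} (hR : 0 < R) :
    deriv (Fpot R) = fun Φ => Φ + √2 * (hFun (R + 1) (Φ / √2) / hFun R (Φ / √2)) := by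
  funext x
  have h := (((hasDerivAt_id x).pow 2).div_const 2).sub
    ((hasDerivAt_hFun_div_sqrt_two hR x).log (hFun_pos hR _).ne')
  refine (HasDerivAt.congr_deriv h ?_).deriv
  simp
  ring

lemma deriv_deriv_Fpot {R : ℝ} (hR : 0 < R) :
    deriv (deriv (Fpot R)) = fun Φ => 1 - 2 * (hFun (R + 2) (Φ / √2) / hFun R (Φ / √2)) +
      2 * (hFun (R + 1) (Φ / √2) / hFun R (Φ / √2)) ^ 2 := by
  rw [deriv_Fpot hR]
  funext x
  have hne := (hFun_pos hR (x / √2)).ne'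
  have h := (hasDerivAt_id x).add (((hasDerivAt_hFun_div_sqrt_two (R := R + 1) (by linarith) x).div
    (hasDerivAt_hFun_div_sqrt_two hR x) hne).const_mul (√2))
  refine (HasDerivAt.congr_deriv h ?_).deriv
  have h2 : √2 ^ 2 = 2 := Real.sq_sqrt two_pos.le
  rw [show R + 1 + 1 = R + 2 by ring]
  field_simp
  rw [h2]
  ring

lemma deriv_deriv_deriv_Fpot {R : ℝ} (hR : 0 < R) (x : ℝ) :
    deriv (deriv (deriv (Fpot R))) x =
      √2 * (2 * (hFun (R + 3) (x / √2) / hFun R (x / √2)) -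
        6 * (hFun (R + 2) (x / √2) / hFun R (x / √2)) * (hFun (R + 1) (x / √2) / hFun R (x / √2)) +
        4 * (hFun (R + 1) (x / √2) / hFun R (x / √2)) ^ 3) := by
  rw [deriv_deriv_Fpot hR]
  have hne := (hFun_pos hR (x / √2)).ne'
  have h0 := hasDerivAt_hFun_div_sqrt_two hR x
  have h1 := (hasDerivAt_hFun_div_sqrt_two (R := R + 1) (by linarith) x).div h0 hne
  have h2 := (hasDerivAt_hFun_div_sqrt_two (R := R + 2) (by linarith) x).div h0 hne
  have h := ((h2.const_mul 2).const_sub 1).add ((h1.pow 2).const_mul 2)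
  refine (HasDerivAt.congr_deriv h ?_).deriv
  simp only [Pi.div_apply, Nat.cast_ofNat, Nat.reduceSub, pow_one]
  rw [show R + 1 + 1 = R + 2 by ring, show R + 2 + 1 = R + 3 by ring]
  field_simp
  ring

lemma hFun_ratio_zero {R : ℝ} (hR : 0 < R) : √2 * (hFun (R + 1) 0 / hFun R 0) = c₁ R := by
  have hG := (Real.Gamma_pos_of_pos (half_pos hR)).ne'
  rw [hFun_zero hR, hFun_zero (by linarith), c₁, add_comm R 1]
  field_simp

/-- For `R > 0`, the potential `F(Φ) = Φ²/2 - log h_R(Φ/√2)` is smooth near `0` with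
`F'(0) = c₁`, `F''(0) = 1 - R + c₁²  (= 2a₂)` and `F'''(0) = 2c₁(c₁² + 1/2 - R) (= 6c₃)`. -/
theorem high_temperature_expansion (R : ℝ) (hR : 0 < R) :
    (∃ U ∈ 𝓝 (0 : ℝ), ContDiffOn ℝ (⊤ : ℕ∞) (Fpot R) U) ∧
    deriv (Fpot R) 0 = c₁ R ∧
    iteratedDeriv 2 (Fpot R) 0 = 1 - R + c₁ R ^ 2 ∧
    iteratedDeriv 3 (Fpot R) 0 = 2 * c₁ R * (c₁ R ^ 2 + 1 / 2 - R) := by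
  have hne := (hFun_pos hR 0).ne'
  have h2 : √2 ^ 2 = 2 := Real.sq_sqrt two_pos.le
  have hratio₂ : hFun (R + 2) 0 / hFun R 0 = R / 2 := by
    rw [hFun_add_two_zero hR, mul_div_cancel_right₀ _ hne]
  have hratio₃ : hFun (R + 3) 0 / hFun R 0 = (R + 1) / 2 * (hFun (R + 1) 0 / hFun R 0) := by
    rw [show R + 3 = R + 1 + 2 by ring, hFun_add_two_zero (by linarith), mul_div_assoc]
  rw [← hFun_ratio_zero hR]
  refine ⟨⟨Set.univ, univ_mem, (contDiff_Fpot hR).contDiffOn⟩, ?_, ?_, ?_⟩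
  · simp [deriv_Fpot hR]
  · rw [iteratedDeriv_succ, iteratedDeriv_one, deriv_deriv_Fpot hR]
    simp only [zero_div, hratio₂]
    linear_combination (-(hFun (R + 1) 0 / hFun R 0) ^ 2) * h2
  · rw [iteratedDeriv_succ, iteratedDeriv_succ, iteratedDeriv_one, deriv_deriv_deriv_Fpot hR]
    simp only [zero_div, hratio₂, hratio₃]
    linear_combination (-2 * √2 * (hFun (R + 1) 0 / hFun R 0) ^ 3) * h2
end

section
/- For every real R > 0, the strict Gamma-function inequality 2·Γ(1 + R/2)² < (1 + R)·Γ((1+R)/2)² holds. Consequently, the quadratic coefficient a₂ = (Γ(1+R/2)/Γ((1+R)/2))² − (1+R)/2 of the low-temperature non-equilibrium Landau potential is strictly negative for all R > 0. -/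
open Real

/-- The weak form of the strict inequality below, from log-convexity of `Γ`. -/
lemma Gamma_add_half_sq_le {x : ℝ} (hx : 0 < x) :
    Real.Gamma (x + 1 / 2) ^ 2 ≤ x * Real.Gamma x ^ 2 := by
  have h := Real.Gamma_mul_add_mul_le_rpow_Gamma_mul_rpow_Gamma hx (by linarith : 0 < x + 1)
    (by norm_num : (0 : ℝ) < 1 / 2) (by norm_num : (0 : ℝ) < 1 / 2) (by norm_num)
  rw [show 1 / 2 * x + 1 / 2 * (x + 1) = x + 1 / 2 by ring, ← Real.sqrt_eq_rpow,
    ← Real.sqrt_eq_rpow, Real.Gamma_add_one hx.ne'] at h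
  have hG := (Real.Gamma_pos_of_pos hx).le
  calc Real.Gamma (x + 1 / 2) ^ 2 ≤ (√(Real.Gamma x) * √(x * Real.Gamma x)) ^ 2 :=
        pow_le_pow_left₀ (Real.Gamma_pos_of_pos (by linarith)).le h 2
    _ = x * Real.Gamma x ^ 2 := by
        rw [mul_pow, Real.sq_sqrt hG, Real.sq_sqrt (mul_nonneg hx.le hG)]
        ring

/-- Strictness follows because `Γ (x + 1 / 2) ^ 2 / (x * Γ x ^ 2)` strictly increases under
`x ↦ x + 1`. -/
lemma Gamma_add_half_sq_lt {x : ℝ} (hx : 0 < x) :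
    Real.Gamma (x + 1 / 2) ^ 2 < x * Real.Gamma x ^ 2 := by
  have hx' : 0 < x + 1 / 2 := by linarith
  have h := Gamma_add_half_sq_le (by linarith : 0 < x + 1)
  rw [show x + 1 + 1 / 2 = x + 1 / 2 + 1 by ring, Real.Gamma_add_one hx'.ne',
    Real.Gamma_add_one hx.ne'] at h
  have hG : 0 < Real.Gamma (x + 1 / 2) ^ 2 := pow_pos (Real.Gamma_pos_of_pos hx') 2
  have hxx : 0 < x * (x + 1) := by positivity
  refine lt_of_mul_lt_mul_left ?_ hxx.le
  linarith

/-- For every `R > 0` one has `2·Γ(1+R/2)² < (1+R)·Γ((1+R)/2)²`; consequently the quadratic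
coefficient `a₂ = (Γ(1+R/2)/Γ((1+R)/2))² - (1+R)/2` of the low-temperature non-equilibrium
Landau potential is strictly negative. -/
theorem gamma_inequality_a2_negative (R : ℝ) (hR : 0 < R) :
    2 * Real.Gamma (1 + R / 2) ^ 2 < (1 + R) * Real.Gamma ((1 + R) / 2) ^ 2 ∧
    (Real.Gamma (1 + R / 2) / Real.Gamma ((1 + R) / 2)) ^ 2 - (1 + R) / 2 < 0 := by
  have hx : 0 < (1 + R) / 2 := by linarith
  have h := Gamma_add_half_sq_lt hx
  rw [show (1 + R) / 2 + 1 / 2 = 1 + R / 2 by ring] at h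
  refine ⟨by linarith, ?_⟩
  rw [div_pow, sub_neg, div_lt_iff₀ (pow_pos (Real.Gamma_pos_of_pos hx) 2)]
  exact h
end
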